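/- arXiv:2310.02581 — 6 statements merged into one kernel-verified Lean document; each statement's English description precedes it below -/
import Mathlib

section
/- For every τ > 0, every δ ∈ (0,2] and every real x with |x| ≤ τ, the derivative of the pseudo-Huber loss satisfies |g_τ(x) − x| ≤ (1/2)·τ^{−δ}·|x|^{1+δ}. -/
noncomputable section

/-- The derivative of the pseudo-Huber loss `f_τ(x) = τ²(√(1+(x/τ)²) − 1)`,
namely `g_τ(x) = x / √(1 + x²/τ²)`. -/
def pseudoHuberDeriv (τ x : ℝ) : ℝ := x / Real.sqrt (1 + x ^ 2 / τ ^ 2)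

/-- Cubic bound on the deviation of `g_τ` from the identity. -/
theorem abs_pseudoHuberDeriv_sub_self_le_mul_sq (τ x : ℝ) :
    |pseudoHuberDeriv τ x - x| ≤ 1 / 2 * (|x| * (|x| / τ) ^ 2) := by
  have hu : 0 ≤ x ^ 2 / τ ^ 2 := by positivity
  have hsq : √(1 + x ^ 2 / τ ^ 2) ^ 2 = 1 + x ^ 2 / τ ^ 2 := Real.sq_sqrt (by linarith)
  have hone : 1 ≤ √(1 + x ^ 2 / τ ^ 2) := Real.one_le_sqrt.mpr (by linarith)
  rw [pseudoHuberDeriv, div_pow, sq_abs]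
  set s := √(1 + x ^ 2 / τ ^ 2)
  have hs : 0 < s := by linarith
  have hinv : |s⁻¹ - 1| ≤ x ^ 2 / τ ^ 2 / 2 := by
    rw [abs_sub_comm, abs_of_nonneg (sub_nonneg.mpr (inv_le_one_of_one_le₀ hone))]
    have hamgm : 2 ≤ s + s⁻¹ := by
      have := mul_inv_cancel₀ hs.ne'
      nlinarith [sq_nonneg (s - 1), inv_pos.mpr hs]
    nlinarith [sq_nonneg (s - 1)]
  calc |x / s - x| = |x| * |s⁻¹ - 1| := by rw [← abs_mul]; ring_nf
    _ ≤ |x| * (x ^ 2 / τ ^ 2 / 2) := by gcongr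
    _ = 1 / 2 * (|x| * (x ^ 2 / τ ^ 2)) := by ring

/-- For every `τ > 0`, `δ ∈ (0,2]` and `|x| ≤ τ`, we have
`|g_τ(x) − x| ≤ (1/2)·τ^{−δ}·|x|^{1+δ}`. -/
theorem pseudoHuberDeriv_sub_self_abs_le (τ δ x : ℝ) (hτ : 0 < τ)
    (hδ : δ ∈ Set.Ioc (0 : ℝ) 2) (hx : |x| ≤ τ) :
    |pseudoHuberDeriv τ x - x| ≤ (1 / 2) * τ ^ (-δ) * |x| ^ (1 + δ) := by
  obtain ⟨hδ0, hδ2⟩ := hδ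
  have hpow : (|x| / τ) ^ 2 ≤ (|x| / τ) ^ δ := by
    rw [← Real.rpow_two]
    exact Real.rpow_le_rpow_of_exponent_ge' (by positivity) ((div_le_one hτ).mpr hx) hδ0.le hδ2
  calc |pseudoHuberDeriv τ x - x| ≤ 1 / 2 * (|x| * (|x| / τ) ^ 2) :=
        abs_pseudoHuberDeriv_sub_self_le_mul_sq τ x
    _ ≤ 1 / 2 * (|x| * (|x| / τ) ^ δ) := by gcongr
    _ = 1 / 2 * τ ^ (-δ) * |x| ^ (1 + δ) := by
      rw [Real.div_rpow (abs_nonneg x) hτ.le, Real.rpow_neg hτ.le,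
        Real.rpow_add' (abs_nonneg x) (by linarith), Real.rpow_one]
      ring
end
end

section
/- For every τ > 0, every δ ∈ (0,1] and every real x with |x| ≤ τ, the second derivative of the pseudo-Huber loss satisfies |g'_τ(x) − 1| ≤ (5/2)·τ^{−1−δ}·|x|^{1+δ}. -/
noncomputable section

/-- The second derivative of the pseudo-Huber loss `f_τ(x) = τ²(√(1+(x/τ)²) − 1)`,
namely `g'_τ(x) = (1 + x²/τ²)^{−3/2}`. -/
def pseudoHuberDeriv2 (τ x : ℝ) : ℝ := (1 + x ^ 2 / τ ^ 2) ^ (-(3 : ℝ) / 2)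

/-- Bernoulli-type lower bound for the exponent `-3/2`. -/
theorem one_sub_two_mul_le_one_add_rpow {s : ℝ} (hs : 0 ≤ s) :
    1 - 2 * s ≤ (1 + s) ^ (-(3 : ℝ) / 2) := by
  have h_mono : (1 + s) ^ (-2 : ℝ) ≤ (1 + s) ^ (-(3 : ℝ) / 2) :=
    Real.rpow_le_rpow_of_exponent_le (by linarith) (by norm_num)
  have h_sq : (1 + s) ^ (-2 : ℝ) = ((1 + s) ^ 2)⁻¹ := by
    rw [Real.rpow_neg (by linarith), Real.rpow_two]
  have h_inv : 1 - 2 * s ≤ ((1 + s) ^ 2)⁻¹ := by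
    rw [← one_div, le_div_iff₀ (by positivity)]
    nlinarith [pow_nonneg hs 2, pow_nonneg hs 3]
  linarith

/-- For every `τ > 0`, `δ ∈ (0,1]` and `|x| ≤ τ`, we have
`|g'_τ(x) − 1| ≤ (5/2)·τ^{−1−δ}·|x|^{1+δ}`. -/
theorem pseudoHuberDeriv2_sub_one_abs_le (τ δ x : ℝ) (hτ : 0 < τ)
    (hδ : δ ∈ Set.Ioc (0 : ℝ) 1) (hx : |x| ≤ τ) :
    |pseudoHuberDeriv2 τ x - 1| ≤ (5 / 2) * τ ^ (-1 - δ) * |x| ^ (1 + δ) := by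
  obtain ⟨hδ0, hδ1⟩ := hδ
  have h_rhs : τ ^ (-1 - δ) * |x| ^ (1 + δ) = (|x| / τ) ^ (1 + δ) := by
    rw [Real.div_rpow (abs_nonneg x) hτ.le, show -1 - δ = -(1 + δ) by ring,
      Real.rpow_neg hτ.le, div_eq_mul_inv, mul_comm]
  have h_sq : x ^ 2 / τ ^ 2 = (|x| / τ) ^ 2 := by rw [div_pow, sq_abs]
  rw [mul_assoc, h_rhs, pseudoHuberDeriv2, h_sq]
  have ht0 : 0 ≤ |x| / τ := by positivity
  have ht1 : |x| / τ ≤ 1 := (div_le_one hτ).2 hx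
  generalize |x| / τ = t at ht0 ht1
  have h_pow : t ^ 2 ≤ t ^ (1 + δ) := by
    rw [← Real.rpow_two]
    exact Real.rpow_le_rpow_of_exponent_ge_of_imp ht0 ht1 (by linarith)
      (fun _ h ↦ by linarith)
  have h_upper : (1 + t ^ 2) ^ (-(3 : ℝ) / 2) ≤ 1 :=
    Real.rpow_le_one_of_one_le_of_nonpos (by nlinarith) (by norm_num)
  have h_lower := one_sub_two_mul_le_one_add_rpow (sq_nonneg t)
  rw [abs_le]
  constructor <;> linarith [sq_nonneg t]
end
end

section
/- Let X be a real random variable on a probability space with E[|X|^{1+δ}] < ∞ for some δ > 1, and let ρ ∈ (0,1). Define the quantile function Q_X(u) = inf{ t ≥ 0 : P(|X| ≥ t) ≤ u } for u ∈ (0,1). Then the integral ∫₀¹ (log u / log ρ) · Q_X(u)² du is finite. -/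
open MeasureTheory

noncomputable section

/-- Markov's inequality for the upper quantile function of `|X|`. -/
theorem upperQuantile_le_rpow {Ω : Type*} [MeasurableSpace Ω] {μ : Measure Ω}
    [IsFiniteMeasure μ] {X : Ω → ℝ} {p M u : ℝ} (hp : 0 < p)
    (hmom : Integrable (fun ω => |X ω| ^ p) μ) (hM : ∫ ω, |X ω| ^ p ∂μ ≤ M)
    (hM0 : 0 < M) (hu : 0 < u) :
    sInf {t : ℝ | 0 ≤ t ∧ μ {ω | t ≤ |X ω|} ≤ ENNReal.ofReal u} ≤ (M / u) ^ p⁻¹ := by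
  have hMu : 0 < M / u := div_pos hM0 hu
  refine csInf_le ⟨0, fun t ht => ht.1⟩ ⟨by positivity, ?_⟩
  have hmarkov := mul_meas_ge_le_integral_of_nonneg
    (Filter.Eventually.of_forall fun ω => Real.rpow_nonneg (abs_nonneg (X ω)) p) hmom (M / u)
  have hset : {ω | (M / u) ^ p⁻¹ ≤ |X ω|} = {ω | M / u ≤ |X ω| ^ p} := by
    ext ω
    exact Real.rpow_inv_le_iff_of_pos hMu.le (abs_nonneg _) hp
  rw [hset, ← ofReal_measureReal]
  refine ENNReal.ofReal_le_ofReal ?_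
  have h : M / u * μ.real {ω | M / u ≤ |X ω| ^ p} ≤ M / u * u := by
    rw [div_mul_cancel₀ _ hu.ne']
    exact hmarkov.trans hM
  exact le_of_mul_le_mul_left h hMu

/-- The logarithm is dominated near `0` by every negative power. -/
theorem neg_log_le_rpow_neg_div {u ε : ℝ} (hu : 0 < u) (hε : 0 < ε) :
    -Real.log u ≤ u ^ (-ε) / ε := by
  have h := Real.log_le_rpow_div (inv_nonneg.2 hu.le) hε
  rwa [Real.log_inv, Real.inv_rpow hu.le, ← Real.rpow_neg hu.le] at h

/-- Let `X` be a real random variable with `E[|X|^{1+δ}] < ∞` for some `δ > 1`, and let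
`ρ ∈ (0,1)`. With the upper quantile function
`Q_X(u) = inf {t ≥ 0 : P(|X| ≥ t) ≤ u}` for `u ∈ (0,1)`, the integral
`∫₀¹ (log u / log ρ) · Q_X(u)² du` is finite. -/
theorem quantile_sq_mixing_integral_finite
    {Ω : Type*} [MeasurableSpace Ω] (μ : Measure Ω) [IsProbabilityMeasure μ]
    (X : Ω → ℝ) (hX : Measurable X) (δ : ℝ) (hδ : 1 < δ)
    (hmom : Integrable (fun ω => |X ω| ^ (1 + δ)) μ)
    (ρ : ℝ) (hρ : ρ ∈ Set.Ioo (0 : ℝ) 1)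
    (Q : ℝ → ℝ)
    (hQ : ∀ u ∈ Set.Ioo (0 : ℝ) 1,
      Q u = sInf {t : ℝ | 0 ≤ t ∧ μ {ω | t ≤ |X ω|} ≤ ENNReal.ofReal u}) :
    ∫⁻ u in Set.Ioo (0 : ℝ) 1,
      ENNReal.ofReal ((Real.log u / Real.log ρ) * (Q u) ^ 2) < ⊤ := by
  obtain ⟨hρ0, hρ1⟩ := hρ
  set p := 1 + δ with hp_def
  have hp : 2 < p := by linarith
  have hp0 : 0 < p := by linarith
  set M := ∫ ω, |X ω| ^ p ∂μ + 1 with hM_def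
  have hM0 : 0 < M := by
    have : 0 ≤ ∫ ω, |X ω| ^ p ∂μ := integral_nonneg fun ω => by positivity
    linarith
  have h2p : p⁻¹ * 2 < 1 := by
    rw [inv_mul_eq_div, div_lt_one hp0]
    exact hp
  set ε := (1 - p⁻¹ * 2) / 2 with hε_def
  have hε : 0 < ε := by linarith
  have hlogρ : 0 < -Real.log ρ := neg_pos.2 (Real.log_neg hρ0 hρ1)
  set C := M ^ (p⁻¹ * 2) / (ε * -Real.log ρ) with hC_def
  have hint : IntegrableOn (fun u : ℝ => C * u ^ (-ε - p⁻¹ * 2)) (Set.Ioo 0 1) :=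
    ((intervalIntegral.integrableOn_Ioo_rpow_iff one_pos).2 (by linarith)).const_mul C
  refine lt_of_le_of_lt (setLIntegral_mono' measurableSet_Ioo fun u hu => ?_)
    hint.lintegral_lt_top
  refine ENNReal.ofReal_le_ofReal ?_
  have hu0 : 0 < u := hu.1
  have hQ0 : 0 ≤ Q u := by
    rw [hQ u hu]
    exact Real.sInf_nonneg fun t ht => ht.1
  have hQle : Q u ≤ (M / u) ^ p⁻¹ := by
    rw [hQ u hu]
    exact upperQuantile_le_rpow hp0 hmom (by linarith) hM0 hu0
  have hQsq : Q u ^ 2 ≤ M ^ (p⁻¹ * 2) * u ^ (-(p⁻¹ * 2)) := by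
    calc Q u ^ 2 ≤ ((M / u) ^ p⁻¹) ^ 2 := pow_le_pow_left₀ hQ0 hQle 2
      _ = (M / u) ^ (p⁻¹ * 2) := by
        rw [Real.rpow_mul (by positivity), Real.rpow_two]
      _ = M ^ (p⁻¹ * 2) * u ^ (-(p⁻¹ * 2)) := by
        rw [Real.div_rpow hM0.le hu0.le, Real.rpow_neg hu0.le, div_eq_mul_inv]
  have hlog : Real.log u / Real.log ρ ≤ u ^ (-ε) / ε / -Real.log ρ := by
    rw [← neg_div_neg_eq]
    exact div_le_div_of_nonneg_right (neg_log_le_rpow_neg_div hu0 hε) hlogρ.le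
  calc Real.log u / Real.log ρ * Q u ^ 2
      ≤ u ^ (-ε) / ε / -Real.log ρ * (M ^ (p⁻¹ * 2) * u ^ (-(p⁻¹ * 2))) :=
        mul_le_mul hlog hQsq (by positivity) (by positivity)
    _ = C * u ^ (-ε - p⁻¹ * 2) := by
        rw [sub_eq_add_neg, Real.rpow_add hu0, hC_def, div_div]
        ring
end
end

section
/- Let Y be a d×d random matrix on a probability space with E[Y] = 0 (entrywise) and operator norm ‖Y‖ ≤ 1 almost surely, and let F be the σ-algebra generated by Y. Then for any sub-σ-algebra G, the conditional expectation satisfies E[ ‖E[Y | G]‖ ] ≤ d·√(2πφ), where φ = sup{ |P(A ∩ B) − P(A)P(B)| : A ∈ F, B ∈ G }. -/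
open MeasureTheory

noncomputable section

/-- The operator (spectral) norm of a real `d × d` matrix. -/
def matOpNorm {d : ℕ} (A : Matrix (Fin d) (Fin d) ℝ) : ℝ :=
  ‖Matrix.toEuclideanCLM (𝕜 := ℝ) A‖

theorem abs_apply_le_matOpNorm {d : ℕ} (A : Matrix (Fin d) (Fin d) ℝ) (i j : Fin d) :
    |A i j| ≤ matOpNorm A := by
  have h := (Matrix.toEuclideanCLM (𝕜 := ℝ) A).le_opNorm (EuclideanSpace.single j 1)
  have h' := PiLp.norm_apply_le
    ((Matrix.toEuclideanCLM (𝕜 := ℝ) A) (EuclideanSpace.single j 1)) i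
  simp only [PiLp.norm_single, norm_one, mul_one] at h
  have e : (Matrix.toEuclideanCLM (𝕜 := ℝ) A) (EuclideanSpace.single j 1) i = A i j := by
    simp [Matrix.ofLp_toEuclideanCLM]
  rw [e, Real.norm_eq_abs] at h'
  exact h'.trans h

theorem matOpNorm_le_sqrt_sum_sq {d : ℕ} (A : Matrix (Fin d) (Fin d) ℝ) :
    matOpNorm A ≤ √(∑ i, ∑ j, A i j ^ 2) := by
  refine ContinuousLinearMap.opNorm_le_bound _ (Real.sqrt_nonneg _) fun x => ?_
  rw [EuclideanSpace.norm_eq, EuclideanSpace.norm_eq, ← Real.sqrt_mul (by positivity)]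
  refine Real.sqrt_le_sqrt ?_
  rw [Finset.sum_mul]
  refine Finset.sum_le_sum fun i _ => ?_
  simp only [Real.norm_eq_abs, sq_abs, Matrix.ofLp_toEuclideanCLM, Matrix.mulVec, dotProduct]
  exact Finset.sum_mul_sq_le_sq_mul_sq _ _ _

theorem comap_entries_le {Ω ι κ : Type*} [m0 : MeasurableSpace Ω] {Y : Ω → Matrix ι κ ℝ}
    (hY : ∀ i j, Measurable fun ω => Y ω i j) :
    MeasurableSpace.comap (fun ω => fun i j => Y ω i j) inferInstance ≤ m0 :=
  Measurable.comap_le <| measurable_pi_lambda _ fun i => measurable_pi_lambda _ fun j => hY i j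

theorem stronglyMeasurable_comap_entries {Ω ι κ : Type*} (Y : Ω → Matrix ι κ ℝ) (i : ι) (j : κ) :
    StronglyMeasurable[MeasurableSpace.comap (fun ω => fun i j => Y ω i j) inferInstance]
      fun ω => Y ω i j := by
  have h : Measurable fun y : ι → κ → ℝ => y i j :=
    (measurable_pi_apply j).comp (measurable_pi_apply i)
  exact (h.comp (comap_measurable fun ω => fun i j => Y ω i j)).stronglyMeasurable

section Mixing

variable {Ω : Type*} {m0 : MeasurableSpace Ω} {μ : Measure Ω}

theorem exists_integral_abs_condExp_eq_two_mul_setIntegral [IsFiniteMeasure μ]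
    {m : MeasurableSpace Ω} (hm : m ≤ m0) {X : Ω → ℝ} (hX : Integrable X μ)
    (hX0 : ∫ ω, X ω ∂μ = 0) :
    ∃ A, MeasurableSet[m] A ∧ ∫ ω, |(μ[X | m]) ω| ∂μ = 2 * ∫ ω in A, X ω ∂μ := by
  have hA : MeasurableSet[m] {ω | 0 ≤ (μ[X | m]) ω} :=
    stronglyMeasurable_condExp.measurable measurableSet_Ici
  refine ⟨_, hA, ?_⟩
  have hint : Integrable (μ[X | m]) μ := integrable_condExp
  have h1 := integral_add_compl (hm _ hA) hint.abs
  have h2 := integral_add_compl (hm _ hA) hint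
  rw [integral_condExp hm, hX0] at h2
  rw [setIntegral_congr_fun (g := μ[X | m]) (hm _ hA) fun ω hω => abs_of_nonneg hω,
    setIntegral_congr_fun (g := fun ω => -(μ[X | m]) ω) (hm _ hA.compl)
      fun ω hω => abs_of_neg (not_le.mp hω), integral_neg] at h1
  rw [← setIntegral_condExp hm hX hA]
  linarith

theorem integral_abs_condExp_le_four_mul [IsProbabilityMeasure μ]
    {F G : MeasurableSpace Ω} (hF : F ≤ m0) (hG : G ≤ m0) {X : Ω → ℝ}
    (hXF : StronglyMeasurable[F] X) (hX : Integrable X μ) (hX0 : ∫ ω, X ω ∂μ = 0)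
    (hX1 : ∀ᵐ ω ∂μ, |X ω| ≤ 1) {φ : ℝ}
    (hφ : ∀ A B, MeasurableSet[F] A → MeasurableSet[G] B →
      |μ.real (A ∩ B) - μ.real A * μ.real B| ≤ φ) :
    ∫ ω, |(μ[X | G]) ω| ∂μ ≤ 4 * φ := by
  obtain ⟨B, hB, hBeq⟩ := exists_integral_abs_condExp_eq_two_mul_setIntegral hG hX hX0
  have hB0 := hG _ hB
  set Z : Ω → ℝ := fun ω => B.indicator 1 ω - μ.real B with hZ
  have hI : Integrable (B.indicator (1 : Ω → ℝ)) μ := (integrable_const 1).indicator hB0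
  have hZi : Integrable Z μ := hI.sub (integrable_const _)
  have hZ0 : ∫ ω, Z ω ∂μ = 0 := by
    rw [hZ, integral_sub hI (integrable_const _), integral_indicator_one hB0]
    simp
  obtain ⟨A, hA, hAeq⟩ := exists_integral_abs_condExp_eq_two_mul_setIntegral hF hZi hZ0
  have hAZ : ∫ ω in A, Z ω ∂μ = μ.real (A ∩ B) - μ.real A * μ.real B := by
    rw [hZ, integral_sub hI.integrableOn (integrable_const _), integral_indicator_one hB0,
      measureReal_restrict_apply hB0, Set.inter_comm]
    simp
  have hXI : (fun ω => X ω * B.indicator 1 ω) = B.indicator X := by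
    ext ω
    by_cases h : ω ∈ B <;> simp [h]
  have hXZ : (X * Z) = fun ω => B.indicator X ω - X ω * μ.real B := by
    ext ω
    simp [hZ, mul_sub, ← hXI]
  have hXZi : Integrable (X * Z) μ := by
    rw [hXZ]
    exact (hX.indicator hB0).sub (hX.mul_const _)
  have hBX : ∫ ω in B, X ω ∂μ = ∫ ω, (X * Z) ω ∂μ := by
    rw [hXZ, integral_sub (hX.indicator hB0) (hX.mul_const _), integral_indicator hB0,
      integral_mul_const, hX0]
    simp
  have hle : ∫ ω, (X * Z) ω ∂μ ≤ ∫ ω, |(μ[Z | F]) ω| ∂μ := by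
    rw [← integral_condExp hF]
    refine integral_mono_ae integrable_condExp integrable_condExp.abs ?_
    filter_upwards [condExp_mul_of_stronglyMeasurable_left hXF hXZi hZi, hX1] with ω h1 h2
    rw [h1, Pi.mul_apply]
    refine (le_abs_self _).trans ?_
    rw [abs_mul]
    exact mul_le_of_le_one_left (abs_nonneg _) h2
  have := (le_abs_self _).trans (hφ A B hA hB)
  linarith

end Mixing

/-- Let `Y` be a `d×d` random matrix with `E[Y] = 0` entrywise and operator norm `‖Y‖ ≤ 1`
almost surely, `F` the σ-algebra generated by `Y`. Then for any sub-σ-algebra `G`,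
`E[‖E[Y | G]‖] ≤ d·√(2πφ)`, where
`φ = sup { |P(A ∩ B) − P(A)P(B)| : A ∈ F, B ∈ G }`. -/
theorem condexp_matrix_opNorm_mixing_bound
    {Ω : Type*} [m0 : MeasurableSpace Ω] (μ : Measure Ω) [IsProbabilityMeasure μ]
    (d : ℕ) (Y : Ω → Matrix (Fin d) (Fin d) ℝ)
    (hYmeas : ∀ i j, Measurable fun ω => Y ω i j)
    (hYint : ∀ i j, Integrable (fun ω => Y ω i j) μ)
    (hmean : ∀ i j, ∫ ω, Y ω i j ∂μ = 0)
    (hnorm : ∀ᵐ ω ∂μ, matOpNorm (Y ω) ≤ 1)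
    (G : MeasurableSpace Ω) (hG : G ≤ m0)
    (φ : ℝ)
    (hφ : φ = sSup {x : ℝ | ∃ A B : Set Ω,
      MeasurableSet[MeasurableSpace.comap (fun ω => fun i j => Y ω i j) inferInstance] A ∧
      MeasurableSet[G] B ∧
      x = |(μ (A ∩ B)).toReal - (μ A).toReal * (μ B).toReal|}) :
    ∫ ω, matOpNorm (Matrix.of fun i j => (μ[fun ω' => Y ω' i j | G]) ω) ∂μ ≤
      d * Real.sqrt (2 * Real.pi * φ) := by
  obtain ⟨F, hFdef⟩ : ∃ F, F = MeasurableSpace.comap (fun ω => fun i j => Y ω i j)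
    inferInstance := ⟨_, rfl⟩
  have hF : F ≤ m0 := hFdef ▸ comap_entries_le (m0 := m0) hYmeas
  have hYF : ∀ i j, StronglyMeasurable[F] fun ω => Y ω i j := fun i j =>
    hFdef ▸ stronglyMeasurable_comap_entries Y i j
  rw [← hFdef] at hφ
  have hφ' : ∀ A B, MeasurableSet[F] A → MeasurableSet[G] B →
      |μ.real (A ∩ B) - μ.real A * μ.real B| ≤ φ := by
    intro A B hA hB
    rw [hφ]
    refine le_csSup ⟨1, ?_⟩ ⟨A, B, hA, hB, rfl⟩
    rintro _ ⟨A, B, -, -, rfl⟩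
    exact abs_sub_le_of_le_of_le measureReal_nonneg measureReal_le_one
      (mul_nonneg measureReal_nonneg measureReal_nonneg)
      (mul_le_one₀ measureReal_le_one measureReal_nonneg measureReal_le_one) |>.trans (by norm_num)
  have hφ0 : 0 ≤ φ := (abs_nonneg _).trans (hφ' ∅ ∅ (by simp) (by simp))
  have hY1 : ∀ i j, ∀ᵐ ω ∂μ, |Y ω i j| ≤ 1 := fun i j => by
    filter_upwards [hnorm] with ω hω using (abs_apply_le_matOpNorm _ i j).trans hω
  set M : Fin d → Fin d → Ω → ℝ := fun i j => μ[fun ω => Y ω i j | G] with hM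
  have hM1 : ∀ᵐ ω ∂μ, ∀ i j, |M i j ω| ≤ 1 := by
    refine ae_all_iff.2 fun i => ae_all_iff.2 fun j => ?_
    exact ae_bdd_abs_condExp_of_ae_bdd_abs (hY1 i j)
  set S : Ω → ℝ := fun ω => ∑ i, ∑ j, |M i j ω| with hS
  have hS0 : ∀ ω, 0 ≤ S ω := fun ω => by positivity
  have hMi : ∀ i j, Integrable (fun ω => |M i j ω|) μ := fun i j => integrable_condExp.abs
  have hSi : Integrable S μ :=
    integrable_finsetSum _ fun i _ => integrable_finsetSum _ fun j _ => hMi i j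
  have hSint : ∫ ω, S ω ∂μ ≤ d ^ 2 * (4 * φ) := by
    rw [hS, integral_finsetSum _ fun i _ => integrable_finsetSum _ fun j _ => hMi i j]
    simp_rw [integral_finsetSum _ fun j _ => hMi _ j]
    refine (Finset.sum_le_sum fun i _ => Finset.sum_le_sum fun j _ =>
      integral_abs_condExp_le_four_mul hF hG (hYF i j) (hYint i j) (hmean i j) (hY1 i j)
        hφ').trans_eq ?_
    simp only [Finset.sum_const, Finset.card_univ, Fintype.card_fin, nsmul_eq_mul]
    ring
  have hsqrt : Integrable (fun ω => √(S ω)) μ := by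
    refine ((integrable_const 1).add hSi).mono'
      (Real.continuous_sqrt.comp_aestronglyMeasurable hSi.1) (.of_forall fun ω => ?_)
    rw [Real.norm_of_nonneg (Real.sqrt_nonneg _), Pi.add_apply]
    exact Real.sqrt_le_iff.2 ⟨by linarith [hS0 ω], by nlinarith [hS0 ω]⟩
  calc
    _ ≤ ∫ ω, √(S ω) ∂μ := by
      refine integral_mono_of_nonneg (.of_forall fun ω => norm_nonneg _) hsqrt ?_
      filter_upwards [hM1] with ω hω
      refine (matOpNorm_le_sqrt_sum_sq _).trans (Real.sqrt_le_sqrt ?_)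
      refine Finset.sum_le_sum fun i _ => Finset.sum_le_sum fun j _ => ?_
      rw [Matrix.of_apply, ← sq_abs]
      exact pow_le_of_le_one (abs_nonneg _) (hω i j) two_ne_zero
    _ ≤ √(∫ ω, S ω ∂μ) :=
      Real.strictConcaveOn_sqrt.concaveOn.le_map_integral Real.continuous_sqrt.continuousOn
        isClosed_Ici (.of_forall hS0) hSi hsqrt
    _ ≤ √(d ^ 2 * (2 * Real.pi * φ)) := by
      refine Real.sqrt_le_sqrt (hSint.trans ?_)
      gcongr
      linarith [Real.pi_gt_three]
    _ = d * √(2 * Real.pi * φ) := by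
      rw [Real.sqrt_mul (by positivity), Real.sqrt_sq (by positivity)]
end
end

section
/- Let X and ε be real random variables on a probability space with E[|X|] < ∞, E[X·ε] = 0, and E[|X|·|ε|^{1+δ}] < ∞ for some δ ∈ (0,2]. Then for every τ > 0, |E[X·g_τ(ε)]| ≤ τ^{−δ}·E[|X|·|ε|^{1+δ}], where g_τ(x) = x/√(1+x²/τ²) is the derivative of the pseudo-Huber loss. -/
open MeasureTheory

noncomputable section

/-- On positive reals, `1 - 1 / √(1 + t²)` is dominated by every power `t ^ δ`, `0 ≤ δ ≤ 2`. -/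
theorem one_sub_inv_sqrt_one_add_sq_le_rpow {t δ : ℝ} (ht : 0 < t) (hδ₀ : 0 ≤ δ) (hδ₂ : δ ≤ 2) :
    1 - (Real.sqrt (1 + t ^ 2))⁻¹ ≤ t ^ δ := by
  have hpos : 0 < Real.sqrt (1 + t ^ 2) := Real.sqrt_pos.2 (by positivity)
  rcases le_total 1 t with h | h
  · have := Real.one_le_rpow h hδ₀
    have := inv_pos.2 hpos
    linarith
  · have hpow : t ^ 2 ≤ t ^ δ := by
      rw [← Real.rpow_natCast]
      exact Real.rpow_le_rpow_of_exponent_ge ht h (by exact_mod_cast hδ₂)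
    have hsqrt : Real.sqrt (1 + t ^ 2) ≤ 1 + t ^ 2 :=
      Real.sqrt_le_iff.2 ⟨by positivity, by nlinarith [sq_nonneg t, sq_nonneg (t ^ 2)]⟩
    have hinv : (1 + t ^ 2)⁻¹ ≤ (Real.sqrt (1 + t ^ 2))⁻¹ := inv_anti₀ hpos hsqrt
    have hsub : 1 - t ^ 2 ≤ (1 + t ^ 2)⁻¹ := by
      rw [← one_div, le_div_iff₀ (by positivity)]
      nlinarith [sq_nonneg (t ^ 2)]
    linarith

/-- The pseudo-Huber score deviates from the identity by at most `τ ^ (-δ) * |x| ^ (1 + δ)`. -/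
theorem abs_pseudoHuberDeriv_sub_self_le {τ δ : ℝ} (hτ : 0 < τ) (hδ₀ : 0 ≤ δ) (hδ₂ : δ ≤ 2)
    (x : ℝ) : |pseudoHuberDeriv τ x - x| ≤ τ ^ (-δ) * |x| ^ (1 + δ) := by
  rcases eq_or_ne x 0 with rfl | hx
  · simp only [pseudoHuberDeriv, zero_div, sub_zero, abs_zero]
    positivity
  have hx' : 0 < |x| := abs_pos.2 hx
  have hquot : x ^ 2 / τ ^ 2 = (|x| / τ) ^ 2 := by rw [div_pow, sq_abs]
  have hbound := one_sub_inv_sqrt_one_add_sq_le_rpow (div_pos hx' hτ) hδ₀ hδ₂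
  have hle : (Real.sqrt (1 + (|x| / τ) ^ 2))⁻¹ ≤ 1 :=
    inv_le_one_of_one_le₀ (Real.one_le_sqrt.2 (by linarith [sq_nonneg (|x| / τ)]))
  calc |pseudoHuberDeriv τ x - x|
      = |x| * (1 - (Real.sqrt (1 + (|x| / τ) ^ 2))⁻¹) := by
        rw [pseudoHuberDeriv, hquot, abs_sub_comm, div_eq_mul_inv, ← mul_one_sub, abs_mul,
          abs_of_nonneg (sub_nonneg.2 hle)]
    _ ≤ |x| * (|x| / τ) ^ δ := by gcongr
    _ = τ ^ (-δ) * |x| ^ (1 + δ) := by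
        rw [Real.div_rpow hx'.le hτ.le, Real.rpow_neg hτ.le, Real.rpow_add hx', Real.rpow_one]
        ring

theorem measurable_pseudoHuberDeriv (τ : ℝ) : Measurable (pseudoHuberDeriv τ) := by
  unfold pseudoHuberDeriv
  fun_prop

/-- If `E[|X|] < ∞`, `E[X·ε] = 0` and `E[|X|·|ε|^{1+δ}] < ∞` for some `δ ∈ (0,2]`,
then for every `τ > 0`, `|E[X·g_τ(ε)]| ≤ τ^{−δ}·E[|X|·|ε|^{1+δ}]`. -/
theorem pseudoHuber_score_bias_bound
    {Ω : Type*} [MeasurableSpace Ω] (μ : Measure Ω) [IsProbabilityMeasure μ]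
    (X ε : Ω → ℝ) (hXmeas : Measurable X) (hεmeas : Measurable ε)
    (δ : ℝ) (hδ : δ ∈ Set.Ioc (0 : ℝ) 2)
    (hXint : Integrable X μ)
    (hmom : Integrable (fun ω => |X ω| * |ε ω| ^ (1 + δ)) μ)
    (hXεint : Integrable (fun ω => X ω * ε ω) μ)
    (hmean : ∫ ω, X ω * ε ω ∂μ = 0)
    (τ : ℝ) (hτ : 0 < τ) :
    |∫ ω, X ω * pseudoHuberDeriv τ (ε ω) ∂μ| ≤
      τ ^ (-δ) * ∫ ω, |X ω| * |ε ω| ^ (1 + δ) ∂μ := by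
  have hbound : ∀ ω, ‖X ω * (pseudoHuberDeriv τ (ε ω) - ε ω)‖ ≤
      τ ^ (-δ) * (|X ω| * |ε ω| ^ (1 + δ)) := fun ω => by
    rw [Real.norm_eq_abs, abs_mul, mul_left_comm]
    gcongr
    exact abs_pseudoHuberDeriv_sub_self_le hτ hδ.1.le hδ.2 (ε ω)
  have hdiff : Integrable (fun ω => X ω * (pseudoHuberDeriv τ (ε ω) - ε ω)) μ :=
    (hmom.const_mul (τ ^ (-δ))).mono'
      (hXmeas.mul (((measurable_pseudoHuberDeriv τ).comp hεmeas).sub hεmeas)).aestronglyMeasurable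
      (.of_forall hbound)
  have hsplit : ∫ ω, X ω * pseudoHuberDeriv τ (ε ω) ∂μ =
      ∫ ω, X ω * (pseudoHuberDeriv τ (ε ω) - ε ω) ∂μ := by
    rw [← add_zero (∫ ω, X ω * (pseudoHuberDeriv τ (ε ω) - ε ω) ∂μ), ← hmean,
      ← integral_add hdiff hXεint]
    congr 1 with ω
    ring
  rw [hsplit, ← integral_const_mul, ← Real.norm_eq_abs]
  exact norm_integral_le_of_norm_le (hmom.const_mul _) (.of_forall hbound)
end
end

section
/- Let X and ε be real random variables on a probability space with E[|X|] < ∞ and E[|X|·|ε|^{1+δ}] < ∞ for some δ ∈ (0,1]. Then for every τ > 0, |E[X·g'_τ(ε)] − E[X]| ≤ (5/2)·τ^{−1−δ}·E[|X|·|ε|^{1+δ}], where g'_τ(x) = (1+x²/τ²)^{−3/2} is the second derivative of the pseudo-Huber loss. -/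
open MeasureTheory

noncomputable section

theorem pseudoHuberDeriv2_nonneg (τ x : ℝ) : 0 ≤ pseudoHuberDeriv2 τ x := by
  unfold pseudoHuberDeriv2
  positivity

theorem pseudoHuberDeriv2_le_one (τ x : ℝ) : pseudoHuberDeriv2 τ x ≤ 1 :=
  Real.rpow_le_one_of_one_le_of_nonpos (le_add_of_nonneg_right (by positivity)) (by norm_num)

theorem measurable_pseudoHuberDeriv2 (τ : ℝ) : Measurable (pseudoHuberDeriv2 τ) := by
  unfold pseudoHuberDeriv2
  fun_prop

theorem one_sub_two_mul_le_rpow {t : ℝ} (ht : 0 ≤ t) :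
    1 - 2 * t ≤ (1 + t) ^ (-(3 : ℝ) / 2) := by
  have hpos : 0 < 1 + t := by linarith
  calc 1 - 2 * t ≤ ((1 + t) ^ 2)⁻¹ := by
        rw [← one_div, le_div_iff₀ (by positivity)]
        nlinarith [pow_nonneg ht 2, pow_nonneg ht 3]
    _ = (1 + t) ^ (-(2 : ℝ)) := by
        rw [Real.rpow_neg hpos.le, Real.rpow_two]
    _ ≤ (1 + t) ^ (-(3 : ℝ) / 2) :=
        Real.rpow_le_rpow_of_exponent_le (by linarith) (by norm_num)

theorem one_sub_pseudoHuberDeriv2_le {τ p : ℝ} (hτ : 0 < τ) (hp : 0 ≤ p) (hp' : p ≤ 2) (x : ℝ) :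
    1 - pseudoHuberDeriv2 τ x ≤ 2 * (τ ^ (-p) * |x| ^ p) := by
  have hscale : τ ^ (-p) * |x| ^ p = (|x| / τ) ^ p := by
    rw [Real.div_rpow (abs_nonneg x) hτ.le, Real.rpow_neg hτ.le, div_eq_inv_mul]
  rw [hscale]
  have hu : 0 ≤ |x| / τ := by positivity
  rcases le_total 1 (|x| / τ) with h | h
  · linarith [Real.one_le_rpow h hp, pseudoHuberDeriv2_nonneg τ x]
  · have hsq : x ^ 2 / τ ^ 2 = (|x| / τ) ^ (2 : ℝ) := by
      rw [Real.rpow_two, div_pow, sq_abs]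
    have hbern : 1 - 2 * (x ^ 2 / τ ^ 2) ≤ pseudoHuberDeriv2 τ x :=
      one_sub_two_mul_le_rpow (by positivity)
    have hpow : (|x| / τ) ^ (2 : ℝ) ≤ (|x| / τ) ^ p := by
      rcases hu.eq_or_lt with h0 | h0
      · rw [← h0, Real.zero_rpow two_ne_zero]
        positivity
      · exact Real.rpow_le_rpow_of_exponent_ge h0 h hp'
    linarith

/-- If `E[|X|] < ∞` and `E[|X|·|ε|^{1+δ}] < ∞` for some `δ ∈ (0,1]`, then for every `τ > 0`,
`|E[X·g'_τ(ε)] − E[X]| ≤ (5/2)·τ^{−1−δ}·E[|X|·|ε|^{1+δ}]`. -/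
theorem pseudoHuber_hessian_bias_bound
    {Ω : Type*} [MeasurableSpace Ω] (μ : Measure Ω) [IsProbabilityMeasure μ]
    (X ε : Ω → ℝ) (hXmeas : Measurable X) (hεmeas : Measurable ε)
    (δ : ℝ) (hδ : δ ∈ Set.Ioc (0 : ℝ) 1)
    (hXint : Integrable X μ)
    (hmom : Integrable (fun ω => |X ω| * |ε ω| ^ (1 + δ)) μ)
    (τ : ℝ) (hτ : 0 < τ) :
    |(∫ ω, X ω * pseudoHuberDeriv2 τ (ε ω) ∂μ) - ∫ ω, X ω ∂μ| ≤
      (5 / 2) * τ ^ (-1 - δ) * ∫ ω, |X ω| * |ε ω| ^ (1 + δ) ∂μ := by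
  have hint : Integrable (fun ω => X ω * pseudoHuberDeriv2 τ (ε ω)) μ := by
    refine hXint.mono
      (hXmeas.mul ((measurable_pseudoHuberDeriv2 τ).comp hεmeas)).aestronglyMeasurable
      (.of_forall fun ω => ?_)
    rw [norm_mul, Real.norm_of_nonneg (pseudoHuberDeriv2_nonneg τ (ε ω))]
    exact mul_le_of_le_one_right (norm_nonneg _) (pseudoHuberDeriv2_le_one τ (ε ω))
  rw [← integral_sub hint hXint, ← integral_const_mul, ← Real.norm_eq_abs]
  refine norm_integral_le_of_norm_le (hmom.const_mul _) (.of_forall fun ω => ?_)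
  have hbound := one_sub_pseudoHuberDeriv2_le hτ (p := 1 + δ) (by linarith [hδ.1])
    (by linarith [hδ.2]) (ε ω)
  rw [neg_add'] at hbound
  have hmom_nonneg : 0 ≤ τ ^ (-1 - δ) * |ε ω| ^ (1 + δ) := by positivity
  calc ‖X ω * pseudoHuberDeriv2 τ (ε ω) - X ω‖
      = |X ω| * (1 - pseudoHuberDeriv2 τ (ε ω)) := by
        rw [← mul_sub_one, norm_mul, Real.norm_eq_abs, Real.norm_eq_abs, abs_sub_comm,
          abs_of_nonneg (sub_nonneg.2 (pseudoHuberDeriv2_le_one τ (ε ω)))]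
    _ ≤ |X ω| * (5 / 2 * (τ ^ (-1 - δ) * |ε ω| ^ (1 + δ))) := by
        gcongr
        linarith
    _ = 5 / 2 * τ ^ (-1 - δ) * (|X ω| * |ε ω| ^ (1 + δ)) := by ring
end
end
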